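/- arXiv:2301.11137 — 3 statements merged into one kernel-verified Lean document; each statement's English description precedes it below -/
import Mathlib

section
/- Let q, x, y₁, y₂, z be complex numbers with |q| < 1 and |x|, |y₁|, |y₂|, |z| ≤ 1. Let 𝒜_{1̄} = {λ = (P,O) ∈ 𝒜 : 1 ∉ O}, and define F(x) = Σ_{λ ∈ 𝒜_{1̄}} x^{♯(λ)} y₁^{♯_{2,4}(λ)} y₂^{♯_{0,4}(λ)} z^{𝖮(λ)} q^{|λ|}. Then Σ_{λ ∈ 𝒜_{1̄}^⋁} x^{♯(λ)} y₁^{♯_{2,4}(λ)} y₂^{♯_{0,4}(λ)} z^{𝖮(λ)} q^{|λ|} = F(x) + x²zq⁶ · F(xq⁸), where all series converge absolutely. -/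
/-- Membership in the set `𝒜`: a pair `(P, O)` with `P` a finite set of positive integers
and `O ⊆ {p ∈ P : p odd}`, such that any two parts `a > b` differ by at least 4, and by at
least 5 whenever `a` is overlined or divisible by 4. -/
def MemA (P O : Finset ℕ) : Prop :=
  (∀ p ∈ P, 0 < p) ∧ O ⊆ P ∧ (∀ p ∈ O, Odd p) ∧
    ∀ a ∈ P, ∀ b ∈ P, b < a →
      4 ≤ a - b ∧ ((a ∈ O ∨ 4 ∣ a) → 5 ≤ a - b)

/-- Membership in the set `𝒜_{1̄}^⋁`: a pair `(P, O)` with `P` a finite set of positive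
integers and `O ⊆ {p ∈ P : p odd, p > 1}`, such that any two parts `a > b` differ by at
least 4 — and by at least 5 if `a` is overlined or divisible by 4 — except that `5̄` and `1`
may appear simultaneously. -/
def MemAVee (P O : Finset ℕ) : Prop :=
  (∀ p ∈ P, 0 < p) ∧ O ⊆ P ∧ (∀ p ∈ O, Odd p ∧ 1 < p) ∧
    ∀ a ∈ P, ∀ b ∈ P, b < a → ¬(a = 5 ∧ a ∈ O ∧ b = 1) →
      4 ≤ a - b ∧ ((a ∈ O ∨ 4 ∣ a) → 5 ≤ a - b)

/-- `♯_{a,M}(λ)`: the number of parts of `λ` congruent to `a` modulo `M`. -/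
def countMod (a M : ℕ) (P : Finset ℕ) : ℕ := (P.filter fun p => p % M = a).card

/-- `F(x) = Σ_{λ ∈ 𝒜_{1̄}} x^{♯(λ)} y₁^{♯_{2,4}(λ)} y₂^{♯_{0,4}(λ)} z^{𝖮(λ)} q^{|λ|}`,
the quinvariate generating function for `𝒜_{1̄} = {λ ∈ 𝒜 : 1̄` is not a part`}`. -/
noncomputable def Fgen (q y₁ y₂ z x : ℂ) : ℂ :=
  ∑' lam : {p : Finset ℕ × Finset ℕ // MemA p.1 p.2 ∧ 1 ∉ p.2},
    x ^ lam.1.1.card * y₁ ^ countMod 2 4 lam.1.1 * y₂ ^ countMod 0 4 lam.1.1 *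
      z ^ lam.1.2.card * q ^ lam.1.1.sum id

/-- The monomial attached to an overpartition `(P, O)`. -/
noncomputable def overpartitionWeight (q y₁ y₂ z x : ℂ) (p : Finset ℕ × Finset ℕ) : ℂ :=
  x ^ p.1.card * y₁ ^ countMod 2 4 p.1 * y₂ ^ countMod 0 4 p.1 * z ^ p.2.card * q ^ p.1.sum id

lemma norm_overpartitionWeight_le (q x y₁ y₂ z : ℂ)
    (hx : ‖x‖ ≤ 1) (hy₁ : ‖y₁‖ ≤ 1) (hy₂ : ‖y₂‖ ≤ 1) (hz : ‖z‖ ≤ 1) (p : Finset ℕ × Finset ℕ) :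
    ‖overpartitionWeight q y₁ y₂ z x p‖ ≤ ‖q‖ ^ p.1.sum id := by
  have one (w : ℂ) (hw : ‖w‖ ≤ 1) (n : ℕ) : ‖w‖ ^ n ≤ 1 := pow_le_one₀ (norm_nonneg w) hw
  simp only [overpartitionWeight, norm_mul, norm_pow]
  refine mul_le_of_le_one_left (by positivity) ?_
  refine mul_le_one₀ (mul_le_one₀ (mul_le_one₀ (one x hx _) (by positivity) (one y₁ hy₁ _))
    (by positivity) (one y₂ hy₂ _)) (by positivity) (one z hz _)

lemma summable_mul_self_of_nonneg {α : Type*} {g : α → ℝ} (hg : Summable g) (hg' : ∀ a, 0 ≤ g a) :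
    Summable fun p : α × α => g p.1 * g p.2 :=
  hg.mul_of_nonneg hg hg' hg'

lemma summable_pow_sum_mul_pow_sum {r : ℝ} (h0 : 0 ≤ r) (h1 : r < 1) :
    Summable fun p : Finset ℕ × Finset ℕ => r ^ p.1.sum id * r ^ p.2.sum id := by
  have h : Summable fun s : Finset ℕ => r ^ s.sum id := by
    refine (summable_finsetProd_of_summable_nonneg (fun n => pow_nonneg h0 n)
      (summable_geometric_of_lt_one h0 h1)).congr fun s => ?_
    exact Finset.prod_pow_eq_pow_sum s id r
  exact summable_mul_self_of_nonneg (g := fun s : Finset ℕ => r ^ s.sum id) h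
    fun _ => pow_nonneg h0 _

lemma summable_overpartitionWeight {q x y₁ y₂ z : ℂ} (hq : ‖q‖ < 1)
    (hx : ‖x‖ ≤ 1) (hy₁ : ‖y₁‖ ≤ 1) (hy₂ : ‖y₂‖ ≤ 1) (hz : ‖z‖ ≤ 1)
    {C : Finset ℕ × Finset ℕ → Prop} (hC : ∀ p, C p → p.2 ⊆ p.1) :
    Summable fun lam : {p // C p} => overpartitionWeight q y₁ y₂ z x lam.1 := by
  have hinj : Function.Injective
      fun lam : {p : Finset ℕ × Finset ℕ // C p} => (lam.1.1 \ lam.1.2, lam.1.2) := by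
    rintro ⟨⟨P, O⟩, h⟩ ⟨⟨P', O'⟩, h'⟩ heq
    obtain ⟨hP, hO⟩ := Prod.mk.inj heq
    dsimp only at hP hO
    subst hO
    have : P = P' := by
      rw [← Finset.sdiff_union_of_subset (show O ⊆ P from hC _ h), hP,
        Finset.sdiff_union_of_subset (show O ⊆ P' from hC _ h')]
    subst this
    rfl
  refine Summable.of_norm_bounded
    ((summable_pow_sum_mul_pow_sum (norm_nonneg q) hq).comp_injective hinj) fun lam => ?_
  refine (norm_overpartitionWeight_le q x y₁ y₂ z hx hy₁ hy₂ hz lam.1).trans_eq ?_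
  simp only [Function.comp_apply, ← pow_add, Finset.sum_sdiff (hC _ lam.2)]

/-- Add `8` to every part, then insert the parts `1` and `5̄`. -/
def shiftInsert (p : Finset ℕ × Finset ℕ) : Finset ℕ × Finset ℕ :=
  (insert 1 (insert 5 (p.1.map (addRightEmbedding 8))), insert 5 (p.2.map (addRightEmbedding 8)))

lemma overpartitionWeight_shiftInsert (q x y₁ y₂ z : ℂ) (p : Finset ℕ × Finset ℕ) :
    overpartitionWeight q y₁ y₂ z x (shiftInsert p) =
      x ^ 2 * z * q ^ 6 * overpartitionWeight q y₁ y₂ z (x * q ^ 8) p := by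
  have h (n : ℕ) (hn : n < 8) (s : Finset ℕ) : n ∉ s.map (addRightEmbedding 8) := by
    simp only [Finset.mem_map, addRightEmbedding_apply]
    rintro ⟨a, -, ha⟩
    omega
  have h1 : 1 ∉ insert 5 (p.1.map (addRightEmbedding 8)) := by
    simp
  have h5 (s : Finset ℕ) := h 5 (by norm_num) s
  have hc (a : ℕ) (ha : a ≠ 1) : countMod a 4 (shiftInsert p).1 = countMod a 4 p.1 := by
    simp [countMod, shiftInsert, Finset.filter_insert, Finset.filter_map, ha.symm,
      show ∀ n, (n + 8) % 4 = n % 4 by omega]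
  have hs : (shiftInsert p).1.sum id = p.1.sum id + 8 * p.1.card + 6 := by
    simp only [shiftInsert, Finset.sum_insert h1, Finset.sum_insert (h5 _), Finset.sum_map]
    simp [Finset.sum_add_distrib]
    ring
  have hP : (shiftInsert p).1.card = p.1.card + 2 := by
    simp only [shiftInsert, Finset.card_insert_of_notMem h1, Finset.card_insert_of_notMem (h5 _),
      Finset.card_map]
  have hO : (shiftInsert p).2.card = p.2.card + 1 := by
    simp only [shiftInsert, Finset.card_insert_of_notMem (h5 _), Finset.card_map]
  simp only [overpartitionWeight, hc 2 (by norm_num), hc 0 (by norm_num), hs, hP, hO]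
  ring

lemma MemA.memAVee {P O : Finset ℕ} (h : MemA P O) (h1 : 1 ∉ O) : MemAVee P O := by
  obtain ⟨hpos, hsub, hodd, hgap⟩ := h
  refine ⟨hpos, hsub, fun p hp => ⟨hodd p hp, ?_⟩, fun a ha b hb hba _ => hgap a ha b hb hba⟩
  have := hpos p (hsub hp)
  have : p ≠ 1 := fun h => h1 (h ▸ hp)
  omega

lemma MemA.not_five_mem_and_one_mem {P O : Finset ℕ} (h : MemA P O) : ¬(5 ∈ O ∧ 1 ∈ P) := by
  rintro ⟨h5, h1⟩
  have := (h.2.2.2 5 (h.2.1 h5) 1 h1 (by norm_num)).2 (Or.inl h5)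
  omega

lemma MemAVee.memA {P O : Finset ℕ} (h : MemAVee P O) (h51 : ¬(5 ∈ O ∧ 1 ∈ P)) :
    MemA P O ∧ 1 ∉ O := by
  obtain ⟨hpos, hsub, hodd, hgap⟩ := h
  refine ⟨⟨hpos, hsub, fun p hp => (hodd p hp).1, fun a ha b hb hba => hgap a ha b hb hba ?_⟩,
    fun h => (hodd 1 h).2.false⟩
  rintro ⟨rfl, h5, rfl⟩
  exact h51 ⟨h5, hb⟩

lemma mem_shiftInsert_fst {p : Finset ℕ × Finset ℕ} {n : ℕ} :
    n ∈ (shiftInsert p).1 ↔ n = 1 ∨ n = 5 ∨ ∃ m ∈ p.1, m + 8 = n := by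
  simp [shiftInsert]

lemma mem_shiftInsert_snd {p : Finset ℕ × Finset ℕ} {n : ℕ} :
    n ∈ (shiftInsert p).2 ↔ n = 5 ∨ ∃ m ∈ p.2, m + 8 = n := by
  simp [shiftInsert]

lemma shiftInsert_injective : Function.Injective shiftInsert := by
  intro p p' h
  ext n
  · have := congrArg (n + 8 ∈ ·.1) h
    simpa [mem_shiftInsert_fst] using this
  · have := congrArg (n + 8 ∈ ·.2) h
    simpa [mem_shiftInsert_snd] using this

lemma memAVee_shiftInsert {p : Finset ℕ × Finset ℕ} (h : MemA p.1 p.2) (h1 : 1 ∉ p.2) :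
    MemAVee (shiftInsert p).1 (shiftInsert p).2 := by
  obtain ⟨hpos, hsub, hodd, hgap⟩ := h
  simp only [MemAVee, mem_shiftInsert_fst, mem_shiftInsert_snd, Finset.subset_iff]
  refine ⟨?_, ?_, ?_, ?_⟩
  · omega
  · rintro n (rfl | ⟨m, hm, rfl⟩)
    · simp
    · exact Or.inr (Or.inr ⟨m, hsub hm, rfl⟩)
  · rintro n (rfl | ⟨m, hm, rfl⟩)
    · decide
    · exact ⟨(hodd m hm).add_even (by decide), by omega⟩
  · rintro a (rfl | rfl | ⟨m, hm, rfl⟩) b (rfl | rfl | ⟨k, hk, rfl⟩) hba hne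
    · omega
    · omega
    · omega
    · exact absurd ⟨rfl, Or.inl rfl, rfl⟩ hne
    · omega
    · omega
    · have := hpos m hm
      omega
    · have := hpos m hm
      refine ⟨by omega, ?_⟩
      rintro ((h | ⟨j, hj, hjm⟩) | h)
      · omega
      · obtain rfl : j = m := by omega
        have : j ≠ 1 := fun h => h1 (h ▸ hj)
        omega
      · omega
    · have := hgap m hm k hk (by omega)
      refine ⟨by omega, ?_⟩
      rintro ((h | ⟨j, hj, hjm⟩) | h)
      · omega
      · obtain rfl : j = m := by omega
        have := this.2 (Or.inl hj)
        omega
      · have := this.2 (Or.inr (by omega))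
        omega

lemma MemAVee.exists_shiftInsert_eq {p : Finset ℕ × Finset ℕ} (h : MemAVee p.1 p.2)
    (h5 : 5 ∈ p.2) (h1 : 1 ∈ p.1) :
    ∃ p', (MemA p'.1 p'.2 ∧ 1 ∉ p'.2) ∧ shiftInsert p' = p := by
  obtain ⟨P, O⟩ := p
  obtain ⟨hpos, hsub, hodd, hgap⟩ := h
  dsimp only at *
  have hinj (s : Finset ℕ) : Set.InjOn (addRightEmbedding 8) (addRightEmbedding 8 ⁻¹' (s : Set ℕ)) :=
    (addRightEmbedding 8).injective.injOn
  have gap5 (n : ℕ) (hn : n ∈ P) (h : 5 < n) := hgap n hn 5 (hsub h5) h (by omega)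
  have gap1 (n : ℕ) (hn : n ∈ P) (h : 1 < n) (h' : n < 5) : False := by
    have := hgap n hn 1 h1 h (by omega)
    omega
  have hcases (n : ℕ) (hn : n ∈ P) : n = 1 ∨ n = 5 ∨ 9 ≤ n := by
    have := hpos n hn
    rcases lt_trichotomy n 5 with h | h | h
    · by_cases h1 : n = 1
      · exact Or.inl h1
      · exact (gap1 n hn (by omega) h).elim
    · omega
    · have := gap5 n hn h
      omega
  refine ⟨(P.preimage _ (hinj P), O.preimage _ (hinj O)), ⟨⟨?_, ?_, ?_, ?_⟩, ?_⟩, ?_⟩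
  · intro n hn
    simp only [Finset.mem_preimage, addRightEmbedding_apply] at hn
    have := hcases _ hn
    omega
  · intro n hn
    simp only [Finset.mem_preimage] at hn ⊢
    exact hsub hn
  · intro n hn
    simp only [Finset.mem_preimage, addRightEmbedding_apply] at hn
    have := (hodd _ hn).1
    rw [Nat.odd_iff] at this ⊢
    omega
  · intro a ha b hb hba
    simp only [Finset.mem_preimage, addRightEmbedding_apply] at ha hb ⊢
    have := hgap _ ha _ hb (by omega) (by omega)
    refine ⟨by omega, fun h => ?_⟩
    have := this.2 (h.imp_right fun h => by omega)
    omega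
  · intro h
    simp only [Finset.mem_preimage, addRightEmbedding_apply] at h
    have := (gap5 _ (hsub h) (by norm_num)).2 (Or.inl h)
    omega
  · ext n
    · simp only [mem_shiftInsert_fst, Finset.mem_preimage, addRightEmbedding_apply]
      constructor
      · rintro (rfl | rfl | ⟨m, hm, rfl⟩)
        exacts [h1, hsub h5, hm]
      · intro hn
        rcases hcases n hn with h | h | h
        · exact Or.inl h
        · exact Or.inr (Or.inl h)
        · have e : n - 8 + 8 = n := by omega
          exact Or.inr (Or.inr ⟨n - 8, e.symm ▸ hn, e⟩)
    · simp only [mem_shiftInsert_snd, Finset.mem_preimage, addRightEmbedding_apply]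
      constructor
      · rintro (rfl | ⟨m, hm, rfl⟩)
        exacts [h5, hm]
      · intro hn
        rcases hcases n (hsub hn) with h | h | h
        · have := (hodd n hn).2
          omega
        · exact Or.inl h
        · have e : n - 8 + 8 = n := by omega
          exact Or.inr ⟨n - 8, e.symm ▸ hn, e⟩

/-- Elements of `𝒜_{1̄}^⋁` either lie in `𝒜_{1̄}` or contain both `5̄` and `1`; the latter arise
from `𝒜_{1̄}` by `shiftInsert`. -/
noncomputable def sumEquivMemAVee :
    {p : Finset ℕ × Finset ℕ // MemA p.1 p.2 ∧ 1 ∉ p.2} ⊕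
      {p : Finset ℕ × Finset ℕ // MemA p.1 p.2 ∧ 1 ∉ p.2} ≃
    {p : Finset ℕ × Finset ℕ // MemAVee p.1 p.2} :=
  Equiv.ofBijective
    (Sum.elim (fun p => ⟨p.1, p.2.1.memAVee p.2.2⟩)
      fun p => ⟨shiftInsert p.1, memAVee_shiftInsert p.2.1 p.2.2⟩) <| by
    constructor
    · refine Function.Injective.sumElim ?_ ?_ ?_
      · intro p p' h
        exact Subtype.ext (Subtype.mk.inj h)
      · intro p p' h
        exact Subtype.ext (shiftInsert_injective (Subtype.mk.inj h))
      · intro p p' h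
        refine p.2.1.not_five_mem_and_one_mem ?_
        rw [Subtype.mk.inj h]
        simp [shiftInsert]
    · rintro ⟨p, hp⟩
      by_cases h : 5 ∈ p.2 ∧ 1 ∈ p.1
      · obtain ⟨p', hp', rfl⟩ := hp.exists_shiftInsert_eq h.1 h.2
        exact ⟨Sum.inr ⟨p', hp'⟩, rfl⟩
      · exact ⟨Sum.inl ⟨p, hp.memA h⟩, rfl⟩

/-- The generating function over `𝒜_{1̄}^⋁` equals `F(x) + x²zq⁶ F(xq⁸)`. -/
theorem genfun_AVee_split (q x y₁ y₂ z : ℂ) (hq : ‖q‖ < 1)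
    (hx : ‖x‖ ≤ 1) (hy₁ : ‖y₁‖ ≤ 1) (hy₂ : ‖y₂‖ ≤ 1) (hz : ‖z‖ ≤ 1) :
    Summable (fun lam : {p : Finset ℕ × Finset ℕ // MemAVee p.1 p.2} =>
      x ^ lam.1.1.card * y₁ ^ countMod 2 4 lam.1.1 * y₂ ^ countMod 0 4 lam.1.1 *
        z ^ lam.1.2.card * q ^ lam.1.1.sum id) ∧
    Summable (fun lam : {p : Finset ℕ × Finset ℕ // MemA p.1 p.2 ∧ 1 ∉ p.2} =>
      x ^ lam.1.1.card * y₁ ^ countMod 2 4 lam.1.1 * y₂ ^ countMod 0 4 lam.1.1 *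
        z ^ lam.1.2.card * q ^ lam.1.1.sum id) ∧
    Summable (fun lam : {p : Finset ℕ × Finset ℕ // MemA p.1 p.2 ∧ 1 ∉ p.2} =>
      (x * q ^ 8) ^ lam.1.1.card * y₁ ^ countMod 2 4 lam.1.1 * y₂ ^ countMod 0 4 lam.1.1 *
        z ^ lam.1.2.card * q ^ lam.1.1.sum id) ∧
    ∑' lam : {p : Finset ℕ × Finset ℕ // MemAVee p.1 p.2},
        x ^ lam.1.1.card * y₁ ^ countMod 2 4 lam.1.1 * y₂ ^ countMod 0 4 lam.1.1 *
          z ^ lam.1.2.card * q ^ lam.1.1.sum id =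
      Fgen q y₁ y₂ z x + x ^ 2 * z * q ^ 6 * Fgen q y₁ y₂ z (x * q ^ 8) := by
  have hxq : ‖x * q ^ 8‖ ≤ 1 := by
    rw [norm_mul, norm_pow]
    exact mul_le_one₀ hx (by positivity) (pow_le_one₀ (norm_nonneg q) hq.le)
  have hV := summable_overpartitionWeight hq hx hy₁ hy₂ hz
    (C := fun p => MemAVee p.1 p.2) fun p hp => hp.2.1
  have hA := summable_overpartitionWeight hq hx hy₁ hy₂ hz
    (C := fun p => MemA p.1 p.2 ∧ 1 ∉ p.2) fun p hp => hp.1.2.1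
  have hA' := summable_overpartitionWeight hq hxq hy₁ hy₂ hz
    (C := fun p => MemA p.1 p.2 ∧ 1 ∉ p.2) fun p hp => hp.1.2.1
  refine ⟨hV, hA, hA', ?_⟩
  change ∑' lam : {p : Finset ℕ × Finset ℕ // MemAVee p.1 p.2},
    overpartitionWeight q y₁ y₂ z x lam.1 = _
  rw [← sumEquivMemAVee.tsum_eq]
  refine HasSum.tsum_eq (HasSum.sum hA.hasSum ?_)
  refine (hA'.hasSum.mul_left (x ^ 2 * z * q ^ 6)).congr_fun ?_
  exact fun p => overpartitionWeight_shiftInsert q x y₁ y₂ z p.1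
end

section
/- Let q, x, y be complex numbers with |q| < 1 and |x|, |y| ≤ 1. Then Σ_{λ ∈ 𝒜_{1̄}^⋁} x^{♯_{1,2}(λ) + 2♯_{0,4}(λ)} y^{♯_{2,4}(λ) + 𝖮(λ)} q^{|λ|} = (−xq;q²)_∞ (−yq²;q⁴)_∞, where the series over 𝒜_{1̄}^⋁ converges absolutely. Equivalently, with A(n,m,ℓ) the number of λ ∈ 𝒜_{1̄}^⋁ with |λ| = n, ♯_{1,2}(λ) + 2♯_{0,4}(λ) = m and ♯_{2,4}(λ) + 𝖮(λ) = ℓ, one has Σ_{ℓ,m,n ≥ 0} A(n,m,ℓ) x^m y^ℓ q^n = (−xq;q²)_∞ (−yq²;q⁴)_∞. -/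
/-- The infinite q-Pochhammer symbol `(a; q)_∞ = ∏_{k=0}^{∞} (1 - a q^k)`. -/
noncomputable def qPochInf (a q : ℂ) : ℂ :=
  ∏' k : ℕ, (1 - a * q ^ k)

/-- `A(n,m,ℓ)`: number of overpartitions `λ = (P,O) ∈ 𝒜_{1̄}^⋁` with `|λ| = n`,
`♯_{1,2}(λ) + 2♯_{0,4}(λ) = m` and `♯_{2,4}(λ) + 𝖮(λ) = ℓ`. -/
noncomputable def Acount (n m ℓ : ℕ) : ℕ :=
  Set.ncard {lam : Finset ℕ × Finset ℕ | MemAVee lam.1 lam.2 ∧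
    lam.1.sum id = n ∧ countMod 1 2 lam.1 + 2 * countMod 0 4 lam.1 = m ∧
    countMod 2 4 lam.1 + lam.2.card = ℓ}

section AVee

open Finset Filter Topology

/-- The weight of a single non-overlined part `p`. -/
noncomputable def partWeight (x y q : ℂ) (p : ℕ) : ℂ :=
  (if p % 2 = 1 then x else 1) * (if p % 4 = 0 then x ^ 2 else 1) *
    (if p % 4 = 2 then y else 1) * q ^ p

/-- The weight of an overpartition `(P, O)`. -/
noncomputable def pairWeight (x y q : ℂ) (lam : Finset ℕ × Finset ℕ) : ℂ :=
  x ^ (countMod 1 2 lam.1 + 2 * countMod 0 4 lam.1) *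
    y ^ (countMod 2 4 lam.1 + lam.2.card) * q ^ lam.1.sum id

lemma pairWeight_eq (x y q : ℂ) (lam : Finset ℕ × Finset ℕ) :
    pairWeight x y q lam = (∏ p ∈ lam.1, partWeight x y q p) * y ^ lam.2.card := by
  simp only [pairWeight, partWeight, countMod, prod_mul_distrib, prod_ite, prod_const, one_pow,
    mul_one, ← prod_pow_eq_pow_sum, id]
  ring

open Classical in
/-- The members of `𝒜_{1̄}^⋁` all of whose parts are at most `N`. -/
noncomputable def boundedAVee (N : ℕ) : Finset (Finset ℕ × Finset ℕ) :=
  ((range (N + 1)).powerset ×ˢ (range (N + 1)).powerset).filter fun lam => MemAVee lam.1 lam.2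

lemma mem_boundedAVee {N : ℕ} {lam : Finset ℕ × Finset ℕ} :
    lam ∈ boundedAVee N ↔ MemAVee lam.1 lam.2 ∧ ∀ p ∈ lam.1, p ≤ N := by
  simp only [boundedAVee, mem_filter, mem_product, mem_powerset, subset_iff, mem_range,
    Nat.lt_succ_iff]
  constructor
  · rintro ⟨⟨h1, -⟩, h2⟩
    exact ⟨h2, fun p hp => h1 hp⟩
  · rintro ⟨h2, h1⟩
    exact ⟨⟨fun _ hp => h1 hp, fun _ hp => h1 (h2.2.1 hp)⟩, h2⟩

/-- The generating polynomial of the members of `𝒜_{1̄}^⋁` with parts at most `N`. -/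
noncomputable def boundedGenfun (x y q : ℂ) (N : ℕ) : ℂ :=
  ∑ lam ∈ boundedAVee N, pairWeight x y q lam

lemma memAVee_insert_plain {N : ℕ} {P O : Finset ℕ} (hN : 0 < N) (hO : N ∉ O)
    (hP : ∀ p ∈ P, p < N) :
    MemAVee (insert N P) O ↔
      MemAVee P O ∧ ∀ b ∈ P, 4 ≤ N - b ∧ (4 ∣ N → 5 ≤ N - b) := by
  constructor
  · rintro ⟨h1, h2, h3, h4⟩
    refine ⟨⟨fun p hp => h1 p (mem_insert_of_mem hp), fun p hp => ?_, h3,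
      fun a ha b hb => h4 a (mem_insert_of_mem ha) b (mem_insert_of_mem hb)⟩, fun b hb => ?_⟩
    · rcases mem_insert.1 (h2 hp) with rfl | h
      · exact absurd hp hO
      · exact h
    · have := h4 N (mem_insert_self _ _) b (mem_insert_of_mem hb) (hP b hb) (by tauto)
      tauto
  · rintro ⟨⟨h1, h2, h3, h4⟩, h5⟩
    refine ⟨fun p hp => ?_, fun p hp => mem_insert_of_mem (h2 hp), h3, fun a ha b hb hab hne => ?_⟩
    · rcases mem_insert.1 hp with rfl | h
      · exact hN
      · exact h1 p h
    · rcases mem_insert.1 ha with rfl | ha' <;> rcases mem_insert.1 hb with rfl | hb'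
      · omega
      · have := h5 b hb'
        tauto
      · have := hP a ha'
        omega
      · exact h4 a ha' b hb' hab hne

lemma memAVee_insert_over {N : ℕ} {P O : Finset ℕ} (hN : Odd N) (hN1 : 1 < N)
    (hO : N ∉ O) (hP : ∀ p ∈ P, p < N) :
    MemAVee (insert N P) (insert N O) ↔
      MemAVee P O ∧ ∀ b ∈ P, (N = 5 ∧ b = 1) ∨ 5 ≤ N - b := by
  constructor
  · rintro ⟨h1, h2, h3, h4⟩
    refine ⟨⟨fun p hp => h1 p (mem_insert_of_mem hp), fun p hp => ?_,
      fun p hp => h3 p (mem_insert_of_mem hp),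
      fun a ha b hb hab hne => ?_⟩, fun b hb => ?_⟩
    · rcases mem_insert.1 (h2 (mem_insert_of_mem hp)) with rfl | h
      · exact absurd hp hO
      · exact h
    · have hne' : a ≠ N := (hP a ha).ne
      have := h4 a (mem_insert_of_mem ha) b (mem_insert_of_mem hb) hab
      simp only [mem_insert, hne', false_or] at this
      exact this hne
    · have := h4 N (mem_insert_self _ _) b (mem_insert_of_mem hb) (hP b hb)
      simp only [mem_insert_self, true_and, true_or, forall_const] at this
      tauto
  · rintro ⟨⟨h1, h2, h3, h4⟩, h5⟩
    refine ⟨fun p hp => ?_, insert_subset_insert _ h2, fun p hp => ?_,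
      fun a ha b hb hab hne => ?_⟩
    · rcases mem_insert.1 hp with rfl | h
      · omega
      · exact h1 p h
    · rcases mem_insert.1 hp with rfl | h
      · exact ⟨hN, hN1⟩
      · exact h3 p h
    · rcases mem_insert.1 ha with rfl | ha' <;> rcases mem_insert.1 hb with rfl | hb'
      · omega
      · simp only [mem_insert_self, true_and] at hne
        have := h5 b hb'
        have h6 : 5 ≤ a - b := by tauto
        exact ⟨by omega, fun _ => h6⟩
      · have := hP a ha'
        omega
      · have hne' : a ≠ N := (hP a ha').ne
        simp only [mem_insert, hne', false_or] at hne ⊢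
        exact h4 a ha' b hb' hab hne

lemma sum_boundedAVee_plain (x y q : ℂ) {N M : ℕ} (hMN : M < N)
    (hM : ∀ b, 0 < b → b < N → (b ≤ M ↔ 4 ≤ N - b ∧ (4 ∣ N → 5 ≤ N - b))) :
    ∑ lam ∈ boundedAVee N with N ∈ lam.1 ∧ N ∉ lam.2, pairWeight x y q lam =
      partWeight x y q N * boundedGenfun x y q M := by
  rw [boundedGenfun, mul_sum]
  refine sum_nbij' (fun lam => (lam.1.erase N, lam.2)) (fun lam => (insert N lam.1, lam.2))
    ?_ ?_ ?_ ?_ ?_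
  · rintro ⟨P, O⟩ h
    simp only [mem_filter, mem_boundedAVee] at h ⊢
    obtain ⟨⟨h1, h2⟩, h3, h4⟩ := h
    have hlt : ∀ p ∈ P.erase N, p < N := fun p hp =>
      lt_of_le_of_ne (h2 p (mem_of_mem_erase hp)) (ne_of_mem_erase hp)
    rw [← insert_erase h3, memAVee_insert_plain (by omega) h4 hlt] at h1
    exact ⟨h1.1, fun p hp => (hM p (h1.1.1 p hp) (hlt p hp)).2 (h1.2 p hp)⟩
  · rintro ⟨P, O⟩ h
    simp only [mem_filter, mem_boundedAVee] at h ⊢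
    obtain ⟨h1, h2⟩ := h
    have hlt : ∀ p ∈ P, p < N := fun p hp => (h2 p hp).trans_lt hMN
    have hO : N ∉ O := fun h => lt_irrefl _ (hlt N (h1.2.1 h))
    refine ⟨⟨(memAVee_insert_plain (by omega) hO hlt).2
      ⟨h1, fun b hb => (hM b (h1.1 b hb) (hlt b hb)).1 (h2 b hb)⟩, fun p hp => ?_⟩,
      mem_insert_self _ _, hO⟩
    rcases mem_insert.1 hp with rfl | h
    · exact le_rfl
    · exact (hlt p h).le
  · rintro ⟨P, O⟩ h
    simp only [mem_filter] at h
    simp only [insert_erase h.2.1]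
  · rintro ⟨P, O⟩ h
    rw [mem_boundedAVee] at h
    have : N ∉ P := fun hp => absurd (h.2 N hp) (by omega)
    simp only [erase_insert this]
  · rintro ⟨P, O⟩ h
    simp only [mem_filter] at h
    simp only [pairWeight_eq]
    rw [← mul_prod_erase P _ h.2.1]
    ring

lemma sum_boundedAVee_over (x y q : ℂ) {N M : ℕ} (hN : Odd N) (hN1 : 1 < N) (hMN : M < N)
    (hM : ∀ b, 0 < b → b < N → (b ≤ M ↔ (N = 5 ∧ b = 1) ∨ 5 ≤ N - b)) :
    ∑ lam ∈ boundedAVee N with N ∈ lam.2, pairWeight x y q lam =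
      y * partWeight x y q N * boundedGenfun x y q M := by
  rw [boundedGenfun, mul_sum]
  refine sum_nbij' (fun lam => (lam.1.erase N, lam.2.erase N))
    (fun lam => (insert N lam.1, insert N lam.2)) ?_ ?_ ?_ ?_ ?_
  · rintro ⟨P, O⟩ h
    simp only [mem_filter, mem_boundedAVee] at h ⊢
    obtain ⟨⟨h1, h2⟩, h4⟩ := h
    have h3 : N ∈ P := h1.2.1 h4
    have hlt : ∀ p ∈ P.erase N, p < N := fun p hp =>
      lt_of_le_of_ne (h2 p (mem_of_mem_erase hp)) (ne_of_mem_erase hp)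
    rw [← insert_erase h3, ← insert_erase h4,
      memAVee_insert_over hN hN1 (notMem_erase _ _) hlt] at h1
    exact ⟨h1.1, fun p hp => (hM p (h1.1.1 p hp) (hlt p hp)).2 (h1.2 p hp)⟩
  · rintro ⟨P, O⟩ h
    simp only [mem_filter, mem_boundedAVee] at h ⊢
    obtain ⟨h1, h2⟩ := h
    have hlt : ∀ p ∈ P, p < N := fun p hp => (h2 p hp).trans_lt hMN
    have hO : N ∉ O := fun h => lt_irrefl _ (hlt N (h1.2.1 h))
    refine ⟨⟨(memAVee_insert_over hN hN1 hO hlt).2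
      ⟨h1, fun b hb => (hM b (h1.1 b hb) (hlt b hb)).1 (h2 b hb)⟩, fun p hp => ?_⟩,
      mem_insert_self _ _⟩
    rcases mem_insert.1 hp with rfl | h
    · exact le_rfl
    · exact (hlt p h).le
  · rintro ⟨P, O⟩ h
    simp only [mem_filter, mem_boundedAVee] at h
    simp only [insert_erase h.2, insert_erase (h.1.1.2.1 h.2)]
  · rintro ⟨P, O⟩ h
    rw [mem_boundedAVee] at h
    have hP : N ∉ P := fun hp => absurd (h.2 N hp) (by omega)
    have hO : N ∉ O := fun hp => hP (h.1.2.1 hp)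
    simp only [erase_insert hP, erase_insert hO]
  · rintro ⟨P, O⟩ h
    simp only [mem_filter, mem_boundedAVee] at h
    simp only [pairWeight_eq]
    rw [← mul_prod_erase P _ (h.1.1.2.1 h.2), ← card_erase_add_one h.2]
    ring

lemma boundedGenfun_split (x y q : ℂ) (N : ℕ) (hN : 0 < N) :
    boundedGenfun x y q N = boundedGenfun x y q (N - 1) +
      ∑ lam ∈ boundedAVee N with N ∈ lam.1 ∧ N ∉ lam.2, pairWeight x y q lam +
      ∑ lam ∈ boundedAVee N with N ∈ lam.2, pairWeight x y q lam := by
  rw [boundedGenfun, ← sum_filter_not_add_sum_filter (boundedAVee N) (fun lam => N ∈ lam.2),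
    ← sum_filter_not_add_sum_filter ((boundedAVee N).filter fun lam => N ∉ lam.2)
      (fun lam => N ∈ lam.1), filter_filter, filter_filter, boundedGenfun]
  congr 2
  · refine sum_congr ?_ fun _ _ => rfl
    ext ⟨P, O⟩
    simp only [mem_filter, mem_boundedAVee]
    constructor
    · rintro ⟨⟨h1, h2⟩, h3, h4⟩
      refine ⟨h1, fun p hp => ?_⟩
      have := h2 p hp
      have : p ≠ N := fun h => h4 (h ▸ hp)
      omega
    · rintro ⟨h1, h2⟩
      have hP : N ∉ P := fun hp => absurd (h2 N hp) (by omega)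
      exact ⟨⟨h1, fun p hp => (h2 p hp).trans (Nat.sub_le _ _)⟩, fun h => hP (h1.2.1 h), hP⟩
  · refine sum_congr ?_ fun _ _ => rfl
    ext ⟨P, O⟩
    simp only [mem_filter]
    tauto

lemma boundedGenfun_zero (x y q : ℂ) : boundedGenfun x y q 0 = 1 := by
  have : boundedAVee 0 = {(∅, ∅)} := by
    ext ⟨P, O⟩
    simp only [mem_boundedAVee, mem_singleton, Prod.mk.injEq]
    constructor
    · rintro ⟨⟨h1, h2, -⟩, h3⟩
      have hP : P = ∅ := eq_empty_of_forall_notMem fun p hp =>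
        absurd (h3 p hp) (by have := h1 p hp; omega)
      subst hP
      exact ⟨rfl, subset_empty.1 h2⟩
    · rintro ⟨rfl, rfl⟩
      simp [MemAVee]
  simp [boundedGenfun, this, pairWeight_eq]

lemma sum_boundedAVee_over_eq_zero (x y q : ℂ) {N : ℕ} (hN : ¬(Odd N ∧ 1 < N)) :
    ∑ lam ∈ boundedAVee N with N ∈ lam.2, pairWeight x y q lam = 0 := by
  rw [filter_eq_empty_iff.2, sum_empty]
  rintro ⟨P, O⟩ h hO
  exact hN ((mem_boundedAVee.1 h).1.2.2.1 N hO)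

lemma boundedGenfun_one (x y q : ℂ) : boundedGenfun x y q 1 = 1 + x * q := by
  rw [boundedGenfun_split _ _ _ _ one_pos, sum_boundedAVee_over_eq_zero _ _ _ (by omega),
    sum_boundedAVee_plain (M := 0) _ _ _ (by omega) (by omega)]
  simp [boundedGenfun_zero, partWeight]

lemma boundedGenfun_five (x y q : ℂ) :
    boundedGenfun x y q 5 = boundedGenfun x y q 4 +
      (1 + y) * x * q ^ 5 * boundedGenfun x y q 1 := by
  rw [boundedGenfun_split _ _ _ _ (by norm_num),
    sum_boundedAVee_over (M := 1) _ _ _ (by decide) (by omega) (by omega) (by omega),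
    sum_boundedAVee_plain (M := 1) _ _ _ (by omega) (by omega)]
  simp [partWeight]
  ring

lemma boundedGenfun_four_mul (x y q : ℂ) (n : ℕ) :
    boundedGenfun x y q (4 * n + 4) = boundedGenfun x y q (4 * n + 3) +
      x ^ 2 * q ^ (4 * n + 4) * boundedGenfun x y q (4 * n - 1) := by
  rw [boundedGenfun_split _ _ _ _ (by omega),
    sum_boundedAVee_over_eq_zero _ _ _ (by rw [Nat.odd_iff]; omega),
    sum_boundedAVee_plain (M := 4 * n - 1) _ _ _ (by omega) (by omega), partWeight,
    if_neg (by omega), if_pos (by omega), if_neg (by omega),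
    show 4 * n + 4 - 1 = 4 * n + 3 by omega]
  ring

lemma boundedGenfun_four_mul_add_two (x y q : ℂ) (n : ℕ) :
    boundedGenfun x y q (4 * n + 2) = boundedGenfun x y q (4 * n + 1) +
      y * q ^ (4 * n + 2) * boundedGenfun x y q (4 * n - 2) := by
  rw [boundedGenfun_split _ _ _ _ (by omega),
    sum_boundedAVee_over_eq_zero _ _ _ (by rw [Nat.odd_iff]; omega),
    sum_boundedAVee_plain (M := 4 * n - 2) _ _ _ (by omega) (by omega), partWeight,
    if_neg (by omega), if_neg (by omega), if_pos (by omega),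
    show 4 * n + 2 - 1 = 4 * n + 1 by omega]
  ring

lemma boundedGenfun_odd (x y q : ℂ) {N : ℕ} (hN : N % 2 = 1) (h1 : N ≠ 1) (h5 : N ≠ 5) :
    boundedGenfun x y q N = boundedGenfun x y q (N - 1) +
      x * q ^ N * boundedGenfun x y q (N - 4) +
      x * y * q ^ N * boundedGenfun x y q (N - 5) := by
  rw [boundedGenfun_split _ _ _ _ (by omega),
    sum_boundedAVee_over (M := N - 5) _ _ _ (Nat.odd_iff.2 hN) (by omega) (by omega) (by omega),
    sum_boundedAVee_plain (M := N - 4) _ _ _ (by omega) (by omega), partWeight,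
    if_pos (by omega), if_neg (by omega), if_neg (by omega)]
  ring

/-- The recurrences satisfied by the generating polynomials `d N` of bounded members of
`𝒜_{1̄}^⋁`, where the bound on the parts is `N - 2`. -/
structure AVeeRec {R : Type*} [CommRing R] (x y q : R) (d : ℕ → R) : Prop where
  zero (n : ℕ) : d (4 * n + 6) = d (4 * n + 5) + x ^ 2 * q ^ (4 * n + 4) * d (4 * n + 1)
  one (n : ℕ) : d (4 * n + 11) = d (4 * n + 10) + x * q ^ (4 * n + 9) * d (4 * n + 7) +
    x * y * q ^ (4 * n + 9) * d (4 * n + 6)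
  two (n : ℕ) : d (4 * n + 4) = d (4 * n + 3) + y * q ^ (4 * n + 2) * d (4 * n)
  three (n : ℕ) : d (4 * n + 5) = d (4 * n + 4) + x * q ^ (4 * n + 3) * d (4 * n + 1) +
    x * y * q ^ (4 * n + 3) * d (4 * n)
  init_zero : d 0 = 1
  init_one : d 1 = 1
  init_two : d 2 = 1
  init_three : d 3 = 1 + x * q
  init_seven : d 7 = d 6 + (1 + y) * x * q ^ 5 * d 3

lemma boundedGenfun_aVeeRec (x y q : ℂ) :
    AVeeRec x y q fun k => boundedGenfun x y q (k - 2) where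
  zero n := by
    have := boundedGenfun_four_mul x y q n
    simpa only [show 4 * n + 6 - 2 = 4 * n + 4 by omega, show 4 * n + 5 - 2 = 4 * n + 3 by omega,
      show 4 * n + 1 - 2 = 4 * n - 1 by omega] using this
  one n := by
    have := boundedGenfun_odd x y q (N := 4 * n + 9) (by omega) (by omega) (by omega)
    simpa only [show 4 * n + 11 - 2 = 4 * n + 9 by omega,
      show 4 * n + 10 - 2 = 4 * n + 8 by omega, show 4 * n + 7 - 2 = 4 * n + 5 by omega,
      show 4 * n + 6 - 2 = 4 * n + 4 by omega, show 4 * n + 9 - 1 = 4 * n + 8 by omega,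
      show 4 * n + 9 - 4 = 4 * n + 5 by omega, show 4 * n + 9 - 5 = 4 * n + 4 by omega] using this
  two n := by
    have := boundedGenfun_four_mul_add_two x y q n
    simpa only [show 4 * n + 4 - 2 = 4 * n + 2 by omega,
      show 4 * n + 3 - 2 = 4 * n + 1 by omega] using this
  three n := by
    have := boundedGenfun_odd x y q (N := 4 * n + 3) (by omega) (by omega) (by omega)
    simpa only [show 4 * n + 5 - 2 = 4 * n + 3 by omega, show 4 * n + 4 - 2 = 4 * n + 2 by omega,
      show 4 * n + 1 - 2 = 4 * n - 1 by omega, show 4 * n + 3 - 1 = 4 * n + 2 by omega,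
      show 4 * n + 3 - 4 = 4 * n - 1 by omega, show 4 * n + 3 - 5 = 4 * n - 2 by omega] using this
  init_zero := boundedGenfun_zero x y q
  init_one := boundedGenfun_zero x y q
  init_two := boundedGenfun_zero x y q
  init_three := boundedGenfun_one x y q
  init_seven := boundedGenfun_five x y q

/-- A recurrence involving only the bounds congruent to `0` and `1` modulo `4`. -/
lemma AVeeRec.elim_two_three {R : Type*} [CommRing R] {x y q : R} {d : ℕ → R}
    (h : AVeeRec x y q d) (m : ℕ) :
    d (4 * m + 14) = (y * q ^ 2 + x * q ^ 3) * q ^ (4 * m + 8) * d (4 * m + 10) -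
      x * y * q ^ 5 * q ^ (4 * m + 8) * q ^ (4 * m + 4) * d (4 * m + 6) +
      d (4 * m + 11) + (x ^ 2 * q ^ 4 + x * y * q ^ 3) * q ^ (4 * m + 8) * d (4 * m + 7) +
      x ^ 3 * y * q ^ 7 * q ^ (4 * m + 8) * q ^ (4 * m + 4) * d (4 * m + 3) := by
  have b3 := h.zero (m + 2)
  have b2 := h.zero (m + 1)
  have b1 := h.zero m
  have a2 := h.three (m + 2)
  have a1 := h.three (m + 1)
  have a0 := h.three m
  have e2 := h.two (m + 2)
  have e1 := h.two (m + 1)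
  have e0 := h.two m
  simp only [mul_add, add_assoc, Nat.reduceMul, Nat.reduceAdd, pow_add] at *
  generalize q ^ (4 * m) = Q at *
  linear_combination b3 - (y * q ^ 2 + x * q ^ 3) * (Q * q ^ 8) * b2 +
    x * y * q ^ 5 * (Q * q ^ 8) * (Q * q ^ 4) * b1 + a2 +
    (x ^ 2 * q ^ 4 - y * q ^ 2) * (Q * q ^ 8) * a1 -
    x ^ 2 * y * q ^ 6 * (Q * q ^ 8) * (Q * q ^ 4) * a0 + e2 +
    (x ^ 2 * q ^ 4 + x * y * q ^ 3) * (Q * q ^ 8) * e1 +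
    x ^ 3 * y * q ^ 7 * (Q * q ^ 8) * (Q * q ^ 4) * e0

/-- A recurrence involving only the bounds congruent to `2` and `3` modulo `4`. -/
lemma AVeeRec.elim_zero_one {R : Type*} [CommRing R] {x y q : R} {e : ℕ → R}
    (h : AVeeRec (x * q ^ 2) y q e) (m : ℕ) :
    e (4 * m + 12) = (y * q ^ 2 + x * q ^ 3) * q ^ (4 * m + 8) * e (4 * m + 8) -
      x * y * q ^ 5 * q ^ (4 * m + 8) * q ^ (4 * m + 4) * e (4 * m + 4) +
      e (4 * m + 9) + (x ^ 2 * q ^ 4 + x * y * q ^ 3) * q ^ (4 * m + 8) * e (4 * m + 5) +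
      x ^ 3 * y * q ^ 7 * q ^ (4 * m + 8) * q ^ (4 * m + 4) * e (4 * m + 1) := by
  have b2 := h.zero (m + 1)
  have b1 := h.zero m
  have c2 := h.one m
  have e2 := h.two (m + 2)
  have e1 := h.two (m + 1)
  simp only [mul_add, add_assoc, Nat.reduceMul, Nat.reduceAdd, pow_add] at *
  generalize q ^ (4 * m) = Q at *
  linear_combination e2 - x * q ^ 3 * (Q * q ^ 8) * e1 + c2 + b2 +
    x * y * q ^ 3 * (Q * q ^ 8) * b1

lemma AVeeRec.shift {R : Type*} [CommRing R] {x y q : R} {d e : ℕ → R}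
    (hd : AVeeRec x y q d) (he : AVeeRec (x * q ^ 2) y q e) (m : ℕ) :
    (d (4 * m + 6) = (1 + x * q) * e (4 * m + 4) ∧
      d (4 * m + 10) = (1 + x * q) * e (4 * m + 8)) ∧
    d (4 * m + 3) = (1 + x * q) * e (4 * m + 1) ∧
      d (4 * m + 7) = (1 + x * q) * e (4 * m + 5) := by
  induction m with
  | zero =>
    have d4 := hd.two 0
    have d5 := hd.three 0
    have d6 := hd.zero 0
    have d8 := hd.two 1
    have d9 := hd.three 1
    have d10 := hd.zero 1
    have e3 := he.init_three
    have e4 := he.two 0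
    have e5 := he.three 0
    have e6 := he.zero 0
    have e7 := he.init_seven
    have e8 := he.two 1
    simp only [mul_zero, mul_one, zero_add, Nat.reduceAdd, hd.init_zero, hd.init_one, he.init_zero,
      he.init_one] at *
    rw [d10, d9, d8, hd.init_seven, d6, d5, d4, hd.init_three, e8, e7, e6, e5, e4, e3]
    refine ⟨⟨?_, ?_⟩, ?_, ?_⟩ <;> ring
  | succ m ih =>
    obtain ⟨⟨ih1, ih2⟩, ih3, ih4⟩ := ih
    have c1 := hd.one m
    have a1 := he.three (m + 1)
    have hc : d (4 * m + 11) = (1 + x * q) * e (4 * m + 9) := by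
      simp only [mul_add, add_assoc, Nat.reduceMul, Nat.reduceAdd, pow_add] at *
      rw [c1, a1, ih1, ih2, ih4]
      ring
    have hb : d (4 * m + 14) = (1 + x * q) * e (4 * m + 12) := by
      rw [hd.elim_two_three, he.elim_zero_one, hc, ih1, ih2, ih3, ih4]
      ring
    exact ⟨⟨ih2, hb⟩, ih4, hc⟩

lemma boundedGenfun_shift (x y q : ℂ) (n : ℕ) :
    boundedGenfun x y q (4 * n + 1) =
      (1 + x * q) * boundedGenfun (x * q ^ 2) y q (4 * n - 1) := by
  have := ((boundedGenfun_aVeeRec x y q).shift (boundedGenfun_aVeeRec (x * q ^ 2) y q) n).2.1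
  simpa only [show 4 * n + 3 - 2 = 4 * n + 1 by omega,
    show 4 * n + 1 - 2 = 4 * n - 1 by omega] using this

lemma boundedGenfun_zero_left (y q : ℂ) (n : ℕ) :
    boundedGenfun 0 y q (4 * n + 2) = ∏ k ∈ range (n + 1), (1 + y * q ^ 2 * (q ^ 4) ^ k) := by
  have h2 := boundedGenfun_four_mul_add_two 0 y q
  induction n with
  | zero =>
    have := h2 0
    simp only [mul_zero, zero_add, Nat.zero_sub, boundedGenfun_zero, boundedGenfun_one] at this ⊢
    simp [this]
  | succ n ih =>
    have h1 : boundedGenfun 0 y q (4 * n + 5) = boundedGenfun 0 y q (4 * n + 2) := by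
      have h0 := boundedGenfun_four_mul 0 y q n
      have h3 := boundedGenfun_odd 0 y q (N := 4 * n + 3) (by omega) (by omega) (by omega)
      have h5 : boundedGenfun 0 y q (4 * n + 5) = boundedGenfun 0 y q (4 * n + 4) := by
        rcases Nat.eq_zero_or_pos n with rfl | hn
        · simpa using boundedGenfun_five 0 y q
        · simpa using boundedGenfun_odd 0 y q (N := 4 * n + 5) (by omega) (by omega) (by omega)
      rw [h5, h0]
      simpa using h3
    have := h2 (n + 1)
    rw [show 4 * (n + 1) + 1 = 4 * n + 5 by ring, h1,
      show 4 * (n + 1) - 2 = 4 * n + 2 by omega] at this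
    rw [prod_range_succ, ← ih, this]
    ring

lemma summable_pow_sum_aVee {r : ℝ} (h0 : 0 ≤ r) (h1 : r < 1) :
    Summable fun lam : {p : Finset ℕ × Finset ℕ // MemAVee p.1 p.2} => r ^ lam.1.1.sum id := by
  have hs0 := Real.sqrt_nonneg r
  have hs1 : √r < 1 := by rwa [Real.sqrt_lt' one_pos, one_pow]
  have hs : Summable fun P : Finset ℕ => ∏ p ∈ P, √r ^ p :=
    summable_finsetProd_of_summable_nonneg (fun _ => by positivity)
      (summable_geometric_of_lt_one hs0 hs1)
  have hnn : 0 ≤ fun P : Finset ℕ => ∏ p ∈ P, √r ^ p := fun P => by positivity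
  refine Summable.of_nonneg_of_le (fun _ => by positivity) ?_
    ((hs.mul_of_nonneg hs hnn hnn).subtype {p : Finset ℕ × Finset ℕ | MemAVee p.1 p.2})
  rintro ⟨⟨P, O⟩, h⟩
  simp only [Function.comp_apply, prod_pow_eq_pow_sum _ (fun p : ℕ => p), id]
  calc r ^ ∑ p ∈ P, p = √r ^ (∑ p ∈ P, p) * √r ^ (∑ p ∈ P, p) := by
        rw [← mul_pow, Real.mul_self_sqrt h0]
    _ ≤ √r ^ (∑ p ∈ P, p) * √r ^ (∑ p ∈ O, p) := by
        gcongr ?_ * ?_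
        exact pow_le_pow_of_le_one hs0 hs1.le (sum_le_sum_of_subset h.2.1)

lemma norm_pairWeight_le {x y : ℂ} (q : ℂ) (hx : ‖x‖ ≤ 1) (hy : ‖y‖ ≤ 1)
    (lam : Finset ℕ × Finset ℕ) : ‖pairWeight x y q lam‖ ≤ ‖q‖ ^ lam.1.sum id := by
  rw [pairWeight, norm_mul, norm_mul, norm_pow, norm_pow, norm_pow]
  have h1 := pow_le_one₀ (norm_nonneg x) hx (n := countMod 1 2 lam.1 + 2 * countMod 0 4 lam.1)
  have h2 := pow_le_one₀ (norm_nonneg y) hy (n := countMod 2 4 lam.1 + lam.2.card)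
  exact mul_le_of_le_one_left (by positivity) (mul_le_one₀ h1 (by positivity) h2)

lemma summable_pairWeight {x y q : ℂ} (hq : ‖q‖ < 1) (hx : ‖x‖ ≤ 1) (hy : ‖y‖ ≤ 1) :
    Summable fun lam : {p : Finset ℕ × Finset ℕ // MemAVee p.1 p.2} => pairWeight x y q lam.1 :=
  .of_norm_bounded (summable_pow_sum_aVee (norm_nonneg q) hq)
    fun lam => norm_pairWeight_le q hx hy lam.1

/-- The generating function of `𝒜_{1̄}^⋁`. -/
noncomputable def genfunAVee (x y q : ℂ) : ℂ :=
  ∑' lam : {p : Finset ℕ × Finset ℕ // MemAVee p.1 p.2}, pairWeight x y q lam.1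

lemma tendsto_boundedGenfun {x y q : ℂ} (hq : ‖q‖ < 1) (hx : ‖x‖ ≤ 1) (hy : ‖y‖ ≤ 1) :
    Tendsto (boundedGenfun x y q) atTop (𝓝 (genfunAVee x y q)) := by
  classical
  have hmono : Monotone fun N =>
      (boundedAVee N).subtype fun p : Finset ℕ × Finset ℕ => MemAVee p.1 p.2 := by
    intro N M hNM lam h
    simp only [mem_subtype, mem_boundedAVee] at h ⊢
    exact ⟨h.1, fun p hp => (h.2 p hp).trans hNM⟩
  have hlim := tendsto_atTop_finset_of_monotone hmono fun lam => ⟨lam.1.1.sup id, by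
    simp only [mem_subtype, mem_boundedAVee]
    exact ⟨lam.2, fun p hp => le_sup (f := id) hp⟩⟩
  refine ((summable_pairWeight hq hx hy).hasSum.comp hlim).congr fun N => ?_
  exact sum_subtype_of_mem (pairWeight x y q) fun lam h => (mem_boundedAVee.1 h).1

lemma norm_mul_sq_pow_le {x q : ℂ} (hq : ‖q‖ < 1) (hx : ‖x‖ ≤ 1) (k : ℕ) :
    ‖x * (q ^ 2) ^ k‖ ≤ 1 := by
  rw [norm_mul, norm_pow, norm_pow]
  exact mul_le_one₀ hx (by positivity)
    (pow_le_one₀ (by positivity) (pow_le_one₀ (norm_nonneg q) hq.le))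

lemma genfunAVee_shift {x y q : ℂ} (hq : ‖q‖ < 1) (hx : ‖x‖ ≤ 1) (hy : ‖y‖ ≤ 1) :
    genfunAVee x y q = (1 + x * q) * genfunAVee (x * q ^ 2) y q := by
  have hx' : ‖x * q ^ 2‖ ≤ 1 := by simpa using norm_mul_sq_pow_le hq hx 1
  have h4 : Tendsto (fun n : ℕ => 4 * n) atTop atTop := tendsto_id.const_mul_atTop' four_pos
  have h1 := (tendsto_boundedGenfun hq hx hy).comp ((tendsto_add_atTop_nat 1).comp h4)
  have h2 := ((tendsto_boundedGenfun hq hx' hy).comp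
    ((tendsto_sub_atTop_nat 1).comp h4)).const_mul (1 + x * q)
  exact tendsto_nhds_unique h1 (h2.congr fun n => (boundedGenfun_shift x y q n).symm)

lemma genfunAVee_eq_prod_mul {x y q : ℂ} (hq : ‖q‖ < 1) (hx : ‖x‖ ≤ 1) (hy : ‖y‖ ≤ 1) (n : ℕ) :
    genfunAVee x y q =
      (∏ k ∈ range n, (1 + x * q * (q ^ 2) ^ k)) * genfunAVee (x * (q ^ 2) ^ n) y q := by
  induction n with
  | zero => simp
  | succ n ih =>
    rw [ih, genfunAVee_shift hq (norm_mul_sq_pow_le hq hx n) hy, prod_range_succ]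
    ring_nf

lemma tendsto_prod_qPochInf (a : ℂ) {q : ℂ} (hq : ‖q‖ < 1) :
    Tendsto (fun n => ∏ k ∈ range n, (1 + a * q ^ k)) atTop (𝓝 (qPochInf (-a) q)) := by
  have h : Multipliable fun k : ℕ => 1 + a * q ^ k := by
    refine multipliable_one_add_of_summable ?_
    simp only [norm_mul, norm_pow]
    exact (summable_geometric_of_lt_one (norm_nonneg q) hq).mul_left _
  simpa only [qPochInf, neg_mul, sub_neg_eq_add] using h.hasProd.tendsto_prod_nat

lemma genfunAVee_zero_left {y q : ℂ} (hq : ‖q‖ < 1) (hy : ‖y‖ ≤ 1) :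
    genfunAVee 0 y q = qPochInf (-(y * q ^ 2)) (q ^ 4) := by
  have h4 : Tendsto (fun n : ℕ => 4 * n) atTop atTop := tendsto_id.const_mul_atTop' four_pos
  have h1 := (tendsto_boundedGenfun (x := 0) hq (by simp) hy).comp
    ((tendsto_add_atTop_nat 2).comp h4)
  have hq4 : ‖q ^ 4‖ < 1 := by
    rw [norm_pow]
    exact pow_lt_one₀ (norm_nonneg q) hq (by norm_num)
  have h2 := (tendsto_prod_qPochInf (y * q ^ 2) hq4).comp (tendsto_add_atTop_nat 1)
  exact tendsto_nhds_unique h1 (h2.congr fun n => (boundedGenfun_zero_left y q n).symm)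

lemma genfunAVee_eq {x y q : ℂ} (hq : ‖q‖ < 1) (hx : ‖x‖ ≤ 1) (hy : ‖y‖ ≤ 1) :
    genfunAVee x y q = qPochInf (-(x * q)) (q ^ 2) * qPochInf (-(y * q ^ 2)) (q ^ 4) := by
  have hq2 : ‖q ^ 2‖ < 1 := by
    rw [norm_pow]
    exact pow_lt_one₀ (norm_nonneg q) hq (by norm_num)
  have hx0 : Tendsto (fun n : ℕ => x * (q ^ 2) ^ n) atTop (𝓝 0) := by
    simpa using (tendsto_pow_atTop_nhds_zero_of_norm_lt_one hq2).const_mul x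
  have hlim : Tendsto (fun n : ℕ => genfunAVee (x * (q ^ 2) ^ n) y q) atTop
      (𝓝 (genfunAVee 0 y q)) := by
    refine tendsto_tsum_of_dominated_convergence (summable_pow_sum_aVee (norm_nonneg q) hq)
      (fun lam => ?_)
      (.of_forall fun n lam => norm_pairWeight_le q (norm_mul_sq_pow_le hq hx n) hy lam.1)
    exact ((hx0.pow _).mul_const _).mul_const _
  rw [← genfunAVee_zero_left hq hy]
  exact tendsto_nhds_unique
    (tendsto_const_nhds.congr fun n => genfunAVee_eq_prod_mul hq hx hy n)
    ((tendsto_prod_qPochInf (x * q) hq2).mul hlim)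

lemma tsum_Acount {x y q : ℂ} (hq : ‖q‖ < 1) (hx : ‖x‖ ≤ 1) (hy : ‖y‖ ≤ 1) :
    ∑' t : ℕ × ℕ × ℕ, (Acount t.1 t.2.1 t.2.2 : ℂ) * x ^ t.2.1 * y ^ t.2.2 * q ^ t.1 =
      genfunAVee x y q := by
  let g : {p : Finset ℕ × Finset ℕ // MemAVee p.1 p.2} → ℕ × ℕ × ℕ := fun lam =>
    (lam.1.1.sum id, countMod 1 2 lam.1.1 + 2 * countMod 0 4 lam.1.1,
      countMod 2 4 lam.1.1 + lam.1.2.card)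
  have hsum : Summable fun c => pairWeight x y q (Equiv.sigmaFiberEquiv g c).1 :=
    (summable_pairWeight hq hx hy).comp_injective (Equiv.sigmaFiberEquiv g).injective
  rw [genfunAVee, ← (Equiv.sigmaFiberEquiv g).tsum_eq, hsum.tsum_sigma]
  refine tsum_congr fun t => ?_
  have hterm : ∀ c : {lam // g lam = t}, pairWeight x y q (Equiv.sigmaFiberEquiv g ⟨t, c⟩).1 =
      x ^ t.2.1 * y ^ t.2.2 * q ^ t.1 := by
    rintro ⟨lam, rfl⟩
    rfl
  have hcard : Nat.card {lam // g lam = t} = Acount t.1 t.2.1 t.2.2 := by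
    rw [Acount, ← Nat.card_coe_set_eq]
    refine Nat.card_congr ((Equiv.subtypeSubtypeEquivSubtypeInter _
      (fun lam : Finset ℕ × Finset ℕ => (lam.1.sum id,
        countMod 1 2 lam.1 + 2 * countMod 0 4 lam.1, countMod 2 4 lam.1 + lam.2.card) = t)).trans
      (Equiv.subtypeEquivRight fun lam => ?_))
    simp only [Prod.ext_iff, Set.mem_ofPred_eq]
  simp only [hterm, tsum_const, hcard, nsmul_eq_mul]
  ring

end AVee

/-- The bivariate generating function for `𝒜_{1̄}^⋁`:
`Σ_{λ ∈ 𝒜_{1̄}^⋁} x^{♯_{1,2}(λ)+2♯_{0,4}(λ)} y^{♯_{2,4}(λ)+𝖮(λ)} q^{|λ|}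
  = (−xq;q²)_∞ (−yq²;q⁴)_∞ = Σ_{ℓ,m,n} A(n,m,ℓ) x^m y^ℓ q^n`. -/
theorem genfun_AVee (q x y : ℂ) (hq : ‖q‖ < 1) (hx : ‖x‖ ≤ 1) (hy : ‖y‖ ≤ 1) :
    Summable (fun lam : {p : Finset ℕ × Finset ℕ // MemAVee p.1 p.2} =>
      x ^ (countMod 1 2 lam.1.1 + 2 * countMod 0 4 lam.1.1) *
        y ^ (countMod 2 4 lam.1.1 + lam.1.2.card) * q ^ lam.1.1.sum id) ∧
    ∑' lam : {p : Finset ℕ × Finset ℕ // MemAVee p.1 p.2},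
        x ^ (countMod 1 2 lam.1.1 + 2 * countMod 0 4 lam.1.1) *
          y ^ (countMod 2 4 lam.1.1 + lam.1.2.card) * q ^ lam.1.1.sum id =
      qPochInf (-(x * q)) (q ^ 2) * qPochInf (-(y * q ^ 2)) (q ^ 4) ∧
    ∑' t : ℕ × ℕ × ℕ, (Acount t.1 t.2.1 t.2.2 : ℂ) * x ^ t.2.1 * y ^ t.2.2 * q ^ t.1 =
      qPochInf (-(x * q)) (q ^ 2) * qPochInf (-(y * q ^ 2)) (q ^ 4) :=
  ⟨summable_pairWeight hq hx hy, genfunAVee_eq hq hx hy,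
    (tsum_Acount hq hx hy).trans (genfunAVee_eq hq hx hy)⟩
end

section
/- Let q, x, a₁, a₂, a₃ be complex numbers with |q| < 1, a₁a₂a₃ ≠ 0, |x| < |a₁a₂a₃|, x ≠ 1, and x q^{n+1} ≠ 1 and x q^{n+1} ≠ a_i for all integers n ≥ 0 and i ∈ {1,2,3}. Define H_{1,2}(a₁,a₂,a₃;x,q) = ((xq/a₁, xq/a₂, xq/a₃; q)_∞ / (xq;q)_∞) · Σ_{n ≥ 0} (x/(a₁a₂a₃))ⁿ (1 − x² q^{4n}) (x, a₁, a₂, a₃; q)_n / ((1 − x)(q, xq/a₁, xq/a₂, xq/a₃; q)_n). Then H_{1,2}(a₁,a₂,a₃;x,q) = (x/(a₁a₂), x/(a₂a₃), x/(a₃a₁); q)_∞ / (x/(a₁a₂a₃); q)_∞ + x(1/a₁ + 1/a₂ + 1/a₃ − x/(a₁a₂a₃)) · (xq/(a₁a₂), xq/(a₂a₃), xq/(a₃a₁); q)_∞ / (xq/(a₁a₂a₃); q)_∞. -/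
/-- The finite q-Pochhammer symbol `(a; q)_n = ∏_{k=0}^{n-1} (1 - a q^k)`. -/
noncomputable def qPoch (a q : ℂ) (n : ℕ) : ℂ :=
  ∏ k ∈ Finset.range n, (1 - a * q ^ k)

/-- Andrews' well-poised series
`H_{1,2}(a₁,a₂,a₃;x,q)
  = ((xq/a₁, xq/a₂, xq/a₃;q)_∞/(xq;q)_∞)
    Σ_{n≥0} (x/(a₁a₂a₃))ⁿ (1−x²q^{4n}) (x,a₁,a₂,a₃;q)_n
      / ((1−x)(q, xq/a₁, xq/a₂, xq/a₃;q)_n)`. -/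
noncomputable def H12 (a₁ a₂ a₃ x q : ℂ) : ℂ :=
  qPochInf (x * q / a₁) q * qPochInf (x * q / a₂) q * qPochInf (x * q / a₃) q /
      qPochInf (x * q) q *
    ∑' n : ℕ,
      (x / (a₁ * a₂ * a₃)) ^ n * (1 - x ^ 2 * q ^ (4 * n)) *
        (qPoch x q n * qPoch a₁ q n * qPoch a₂ q n * qPoch a₃ q n) /
        ((1 - x) *
          (qPoch q q n * qPoch (x * q / a₁) q n * qPoch (x * q / a₂) q n *
            qPoch (x * q / a₃) q n))

open Filter Topology Finset

section QPochhammer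

variable {q : ℂ}

lemma qPoch_succ (a q : ℂ) (n : ℕ) : qPoch a q (n + 1) = qPoch a q n * (1 - a * q ^ n) :=
  prod_range_succ _ _

lemma summable_norm_mul_pow (hq : ‖q‖ < 1) (a : ℂ) : Summable fun k : ℕ => ‖-(a * q ^ k)‖ := by
  simpa using (summable_geometric_of_lt_one (norm_nonneg q) hq).mul_left ‖a‖

lemma multipliable_one_sub_mul_pow (hq : ‖q‖ < 1) (a : ℂ) :
    Multipliable fun k : ℕ => 1 - a * q ^ k := by
  simpa [sub_eq_add_neg] using multipliable_one_add_of_summable (summable_norm_mul_pow hq a)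

lemma qPochInf_ne_zero (hq : ‖q‖ < 1) {a : ℂ} (ha : ∀ k : ℕ, a * q ^ k ≠ 1) :
    qPochInf a q ≠ 0 := by
  have h := tprod_one_add_ne_zero_of_summable (f := fun k : ℕ => -(a * q ^ k))
    (fun k h => ha k (by linear_combination -h)) (summable_norm_mul_pow hq a)
  simpa [qPochInf, sub_eq_add_neg] using h

lemma mul_pow_ne_one (hq : ‖q‖ < 1) {a : ℂ} (ha : ‖a‖ < 1) (k : ℕ) : a * q ^ k ≠ 1 := by
  intro h
  have h1 : ‖a‖ * ‖q‖ ^ k = 1 := by simpa using congrArg norm h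
  have h2 : ‖q‖ ^ k ≤ 1 := pow_le_one₀ (norm_nonneg q) hq.le
  nlinarith [norm_nonneg a]

lemma tendsto_qPoch (hq : ‖q‖ < 1) (a : ℂ) :
    Tendsto (qPoch a q) atTop (𝓝 (qPochInf a q)) :=
  (multipliable_one_sub_mul_pow hq a).hasProd.tendsto_prod_nat

lemma qPoch_mul_qPochInf (hq : ‖q‖ < 1) (a : ℂ) (n : ℕ) :
    qPoch a q n * qPochInf (a * q ^ n) q = qPochInf a q := by
  have h : Multipliable fun k : ℕ => 1 - a * q ^ (k + n) := by
    simpa [pow_add, mul_assoc, mul_comm, mul_left_comm] using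
      multipliable_one_sub_mul_pow hq (a * q ^ n)
  have h1 := Multipliable.prod_mul_tprod_nat_mul' (f := fun k : ℕ => 1 - a * q ^ k) h
  simpa [qPoch, qPochInf, pow_add, mul_assoc, mul_comm, mul_left_comm] using h1

lemma one_sub_mul_qPochInf (hq : ‖q‖ < 1) (a : ℂ) :
    (1 - a) * qPochInf (a * q) q = qPochInf a q := by
  simpa [qPoch] using qPoch_mul_qPochInf hq a 1

lemma qPoch_ne_zero {a : ℂ} (ha : ∀ k : ℕ, a * q ^ k ≠ 1) (n : ℕ) : qPoch a q n ≠ 0 :=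
  prod_ne_zero_iff.2 fun k _ h => ha k (by linear_combination -h)

lemma tendsto_qPochInf_mul_pow (hq : ‖q‖ < 1) (a : ℂ) :
    Tendsto (fun n : ℕ => qPochInf (a * q ^ n) q) atTop (𝓝 1) := by
  have h0 : Tendsto (fun n : ℕ => ‖a * q ^ n‖) atTop (𝓝 0) := by
    simpa using ((tendsto_pow_atTop_nhds_zero_of_norm_lt_one hq).const_mul a).norm
  obtain ⟨M, hM⟩ := (h0.eventually_lt_const one_pos).exists
  have hne := mul_pow_ne_one hq hM
  have hI := qPochInf_ne_zero hq hne
  rw [← tendsto_add_atTop_iff_nat M]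
  have h1 := (tendsto_const_nhds (x := qPochInf (a * q ^ M) q)).div
    (tendsto_qPoch hq (a * q ^ M)) hI
  rw [div_self hI] at h1
  refine h1.congr fun n => ?_
  rw [Pi.div_apply, div_eq_iff (qPoch_ne_zero hne n), ← qPoch_mul_qPochInf hq (a * q ^ M) n,
    mul_comm, pow_add, mul_assoc, mul_comm (q ^ M)]

end QPochhammer

lemma tsum_eq_zero_of_telescoping {f G : ℕ → ℂ} (hf : Summable f)
    (hG : Tendsto G atTop (𝓝 0)) (hG0 : G 0 = 0) (h : ∀ n, f n = G (n + 1) - G n) :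
    ∑' n, f n = 0 := by
  refine tendsto_nhds_unique hf.hasSum.tendsto_sum_nat (hG.congr fun n => ?_)
  rw [sum_congr rfl fun k _ => h k, sum_range_sub, hG0, sub_zero]

section WellPoised

variable {a b c q w : ℂ}

/-- The ratio of infinite products in the `n`-th term of a well-poised series with base
`x = w * a * b * c`. -/
noncomputable def wellPoisedTail (a b c q w : ℂ) (n : ℕ) : ℂ :=
  qPochInf (w * b * c * q ^ (n + 1)) q * qPochInf (w * a * c * q ^ (n + 1)) q *
    qPochInf (w * a * b * q ^ (n + 1)) q / qPochInf (w * a * b * c * q ^ n) q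

/-- The ratio of finite products in the `n`-th term of a well-poised series. -/
noncomputable def wellPoisedHead (a b c q : ℂ) (n : ℕ) : ℂ :=
  qPoch a q n * qPoch b q n * qPoch c q n / qPoch q q n

/-- The `n`-th term of the well-poised series with base `x = w * a * b * c` and argument `w`,
normalised by its infinite products. -/
noncomputable def wellPoisedTerm (a b c q w : ℂ) (n : ℕ) : ℂ :=
  wellPoisedTail a b c q w n * wellPoisedHead a b c q n * w ^ n

lemma tendsto_wellPoisedTail (hq : ‖q‖ < 1) :
    Tendsto (wellPoisedTail a b c q w) atTop (𝓝 1) := by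
  have h (u : ℂ) := (tendsto_add_atTop_iff_nat 1).2 (tendsto_qPochInf_mul_pow hq u)
  have hlim := (((h (w * b * c)).mul (h (w * a * c))).mul (h (w * a * b))).div
    (tendsto_qPochInf_mul_pow hq (w * a * b * c)) one_ne_zero
  rwa [mul_one, mul_one, div_one] at hlim

lemma tendsto_wellPoisedHead (hq : ‖q‖ < 1) :
    Tendsto (wellPoisedHead a b c q) atTop
      (𝓝 (qPochInf a q * qPochInf b q * qPochInf c q / qPochInf q q)) :=
  (((tendsto_qPoch hq a).mul (tendsto_qPoch hq b)).mul (tendsto_qPoch hq c)).div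
    (tendsto_qPoch hq q) (qPochInf_ne_zero hq (mul_pow_ne_one hq hq))

lemma wellPoisedTail_mul_pow (N n : ℕ) :
    wellPoisedTail a b c q (w * q ^ N) n = wellPoisedTail a b c q w (N + n) := by
  simp only [wellPoisedTail]
  ring_nf

lemma exists_norm_wellPoisedTerm_le (hq : ‖q‖ < 1) (a b c w : ℂ) :
    ∃ C, 0 ≤ C ∧ ∀ N n : ℕ, ‖wellPoisedTerm a b c q (w * q ^ N) n‖ ≤ C * ‖w * q ^ N‖ ^ n := by
  obtain ⟨A, hA⟩ := (Metric.isBounded_range_of_tendsto _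
    (tendsto_wellPoisedTail (a := a) (b := b) (c := c) (w := w) hq)).exists_norm_le
  obtain ⟨B, hB⟩ := (Metric.isBounded_range_of_tendsto _
    (tendsto_wellPoisedHead (a := a) (b := b) (c := c) hq)).exists_norm_le
  have hA0 : 0 ≤ A := (norm_nonneg _).trans (hA _ ⟨0, rfl⟩)
  have hB0 : 0 ≤ B := (norm_nonneg _).trans (hB _ ⟨0, rfl⟩)
  refine ⟨A * B, mul_nonneg hA0 hB0, fun N n => ?_⟩
  rw [wellPoisedTerm, wellPoisedTail_mul_pow, norm_mul, norm_mul, norm_pow]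
  gcongr
  exacts [hA _ ⟨_, rfl⟩, hB _ ⟨_, rfl⟩]

/-- Comparison of the contiguous terms `(w, n)`, `(w * q, n)` and `(w, n + 1)`. -/
lemma exists_wellPoisedTerm_eq (hq : ‖q‖ < 1) (hx : ∀ k : ℕ, w * a * b * c * q ^ k ≠ 1) (n : ℕ) :
    ∃ V : ℂ,
      wellPoisedTerm a b c q w n = V * ((1 - w * b * c * q * q ^ n) * (1 - w * a * c * q * q ^ n) *
        (1 - w * a * b * q * q ^ n)) ∧
      wellPoisedTerm a b c q (w * q) n = V * (q ^ n * (1 - w * a * b * c * q ^ n)) ∧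
      wellPoisedTerm a b c q w (n + 1) * (1 - q * q ^ n) =
        V * (w * (1 - a * q ^ n) * (1 - b * q ^ n) * (1 - c * q ^ n) *
          (1 - w * a * b * c * q ^ n)) := by
  have hI (u : ℂ) (m : ℕ) :
      qPochInf (u * q ^ m) q = (1 - u * q ^ m) * qPochInf (u * q ^ (m + 1)) q := by
    rw [← one_sub_mul_qPochInf hq (u * q ^ m), pow_succ, mul_assoc]
  have hI' (u : ℂ) :
      qPochInf (u * q ^ (n + 1)) q = (1 - u * q * q ^ n) * qPochInf (u * q ^ (n + 1 + 1)) q := by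
    rw [hI, pow_succ' q n, mul_assoc u]
  have hX : qPochInf (w * a * b * c * q ^ (n + 1)) q ≠ 0 :=
    qPochInf_ne_zero hq fun k => by simpa [pow_add, mul_assoc] using hx (n + 1 + k)
  have h1 : 1 - w * a * b * c * q ^ n ≠ 0 := fun h => hx n (by linear_combination -h)
  have hQ : qPoch q q n ≠ 0 := qPoch_ne_zero (mul_pow_ne_one hq hq) n
  have h2 : 1 - q * q ^ n ≠ 0 :=
    fun h => mul_pow_ne_one hq hq n (by linear_combination -h)
  have hT : wellPoisedTail a b c q (w * q) n = wellPoisedTail a b c q w (n + 1) := by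
    simpa [add_comm] using wellPoisedTail_mul_pow (a := a) (b := b) (c := c) (q := q) (w := w) 1 n
  refine ⟨wellPoisedTail a b c q w (n + 1) / (1 - w * a * b * c * q ^ n) *
    wellPoisedHead a b c q n * w ^ n, ?_, ?_, ?_⟩
  · simp only [wellPoisedTerm, wellPoisedTail]
    rw [hI _ n, hI' (w * b * c), hI' (w * a * c), hI' (w * a * b)]
    generalize 1 - w * a * b * c * q ^ n = d at *
    generalize qPochInf (w * a * b * c * q ^ (n + 1)) q = X at *
    field_simp
  · rw [wellPoisedTerm, hT, mul_pow]
    generalize 1 - w * a * b * c * q ^ n = d at *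
    field_simp
  · simp only [wellPoisedTerm, wellPoisedHead, qPoch_succ, pow_succ w]
    generalize 1 - w * a * b * c * q ^ n = d at *
    generalize 1 - q * q ^ n = e at *
    field_simp

lemma summable_wellPoisedTerm_mul (hq : ‖q‖ < 1) (hw : ‖w‖ < 1) {g : ℕ → ℂ} {l : ℂ}
    (hg : Tendsto g atTop (𝓝 l)) : Summable fun n => wellPoisedTerm a b c q w n * g n := by
  obtain ⟨C, hC0, hC⟩ := exists_norm_wellPoisedTerm_le hq a b c w
  obtain ⟨B, hB⟩ := (Metric.isBounded_range_of_tendsto _ hg).exists_norm_le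
  refine Summable.of_norm_bounded
    ((summable_geometric_of_lt_one (norm_nonneg w) hw).mul_left (C * B)) fun n => ?_
  have h1 := hC 0 n
  rw [pow_zero, mul_one] at h1
  rw [norm_mul, mul_right_comm]
  exact mul_le_mul h1 (hB _ ⟨n, rfl⟩) (norm_nonneg _) (by positivity)

lemma summable_veryWellPoised (hq : ‖q‖ < 1) (hw : ‖w‖ < 1) (x : ℂ) :
    Summable fun n : ℕ => wellPoisedTerm a b c q w n * (q ^ n * (1 - x * (q ^ n) ^ 2)) := by
  have hp := tendsto_pow_atTop_nhds_zero_of_norm_lt_one hq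
  exact summable_wellPoisedTerm_mul hq hw (hp.mul (((hp.pow 2).const_mul x).const_sub 1))

/-- The very-well-poised series, as a function of its argument. -/
noncomputable def veryWellPoisedSum (a b c q w : ℂ) : ℂ :=
  ∑' n : ℕ, wellPoisedTerm a b c q w n * (q ^ n * (1 - w * a * b * c * (q ^ n) ^ 2))

lemma veryWellPoisedSum_contiguous (hq : ‖q‖ < 1) (hw : ‖w‖ < 1)
    (hx : ∀ k : ℕ, w * a * b * c * q ^ k ≠ 1) :
    (1 - w * q) * veryWellPoisedSum a b c q w =
      (1 - w * a * q) * (1 - w * b * q) * (1 - w * c * q) *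
        veryWellPoisedSum a b c q (w * q) := by
  have hp := tendsto_pow_atTop_nhds_zero_of_norm_lt_one hq
  have hwq : ‖w * q‖ < 1 := by
    rw [norm_mul]; exact mul_lt_one_of_nonneg_of_lt_one_left (norm_nonneg _) hw hq.le
  have hs1 := (summable_veryWellPoised (a := a) (b := b) (c := c) hq hw
    (w * a * b * c)).mul_left (1 - w * q)
  have hs2 := (summable_veryWellPoised (a := a) (b := b) (c := c) hq hwq
    (w * q * a * b * c)).mul_left ((1 - w * a * q) * (1 - w * b * q) * (1 - w * c * q))
  rw [← sub_eq_zero, veryWellPoisedSum, veryWellPoisedSum, ← tsum_mul_left, ← tsum_mul_left,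
    ← hs1.tsum_sub hs2]
  refine tsum_eq_zero_of_telescoping (hs1.sub hs2)
    (G := fun n => wellPoisedTerm a b c q w n *
      (q ^ n * (1 - q ^ n) * (w ^ 2 * a * b * c * q * q ^ n - 1))) ?_ (by simp) fun n => ?_
  · exact (summable_wellPoisedTerm_mul hq hw ((hp.mul (hp.const_sub 1)).mul
      ((hp.const_mul _).sub_const 1))).tendsto_atTop_zero
  · obtain ⟨V, h1, h2, h3⟩ := exists_wellPoisedTerm_eq hq hx n
    simp only [h1, h2, pow_succ q n]
    linear_combination (-q * q ^ n * (w ^ 2 * a * b * c * q * q ^ n * q - 1)) * h3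

lemma tendsto_veryWellPoisedSum (hq : ‖q‖ < 1) (hw : ‖w‖ < 1) :
    Tendsto (fun N : ℕ => veryWellPoisedSum a b c q (w * q ^ N)) atTop (𝓝 1) := by
  have hp := tendsto_pow_atTop_nhds_zero_of_norm_lt_one hq
  have hwp : Tendsto (fun N : ℕ => w * q ^ N) atTop (𝓝 0) := by simpa using hp.const_mul w
  obtain ⟨C, hC0, hC⟩ := exists_norm_wellPoisedTerm_le hq a b c w
  have hle (N : ℕ) : ‖w * q ^ N‖ ≤ ‖w‖ := by
    rw [norm_mul, norm_pow]
    exact mul_le_of_le_one_right (norm_nonneg _) (pow_le_one₀ (norm_nonneg q) hq.le)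
  have hB (N n : ℕ) : ‖q ^ n * (1 - w * q ^ N * a * b * c * (q ^ n) ^ 2)‖ ≤
      1 + ‖w‖ * ‖a‖ * ‖b‖ * ‖c‖ := by
    have hqn : ‖q ^ n‖ ≤ 1 := by
      rw [norm_pow]; exact pow_le_one₀ (norm_nonneg q) hq.le
    have h1 : ‖w * q ^ N * a * b * c * (q ^ n) ^ 2‖ ≤ ‖w‖ * ‖a‖ * ‖b‖ * ‖c‖ * 1 := by
      rw [norm_mul, norm_mul, norm_mul, norm_mul, norm_pow (q ^ n)]
      gcongr
      exacts [hle N, pow_le_one₀ (norm_nonneg _) hqn]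
    have h2 := norm_sub_le 1 (w * q ^ N * a * b * c * (q ^ n) ^ 2)
    rw [norm_one] at h2
    rw [norm_mul]
    nlinarith [norm_nonneg (1 - w * q ^ N * a * b * c * (q ^ n) ^ 2), norm_nonneg (q ^ n)]
  have hb (N n : ℕ) : ‖wellPoisedTerm a b c q (w * q ^ N) n *
      (q ^ n * (1 - w * q ^ N * a * b * c * (q ^ n) ^ 2))‖ ≤
      C * ‖w * q ^ N‖ ^ n * (1 + ‖w‖ * ‖a‖ * ‖b‖ * ‖c‖) := by
    rw [norm_mul]
    exact mul_le_mul (hC N n) (hB N n) (norm_nonneg _) (by positivity)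
  have hsum : Summable fun n : ℕ => C * ‖w‖ ^ n * (1 + ‖w‖ * ‖a‖ * ‖b‖ * ‖c‖) :=
    ((summable_geometric_of_lt_one (norm_nonneg w) hw).mul_left C).mul_right _
  have key := tendsto_tsum_of_dominated_convergence (𝓕 := atTop)
    (f := fun N n : ℕ => wellPoisedTerm a b c q (w * q ^ N) n *
      (q ^ n * (1 - w * q ^ N * a * b * c * (q ^ n) ^ 2)))
    (g := fun n => if n = 0 then 1 else 0) hsum (fun n => ?_)
    (Eventually.of_forall fun N n => (hb N n).trans (by gcongr; exact hle N))
  · simpa [veryWellPoisedSum] using key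
  · rcases eq_or_ne n 0 with rfl | hn
    · have h1 : Tendsto (fun N : ℕ => w * q ^ N * a * b * c) atTop (𝓝 0) := by
        simpa using ((hwp.mul_const a).mul_const b).mul_const c
      simpa [wellPoisedTerm, wellPoisedTail_mul_pow, wellPoisedHead, qPoch] using
        (tendsto_wellPoisedTail (a := a) (b := b) (c := c) (w := w) hq).mul (h1.const_sub 1)
    · rw [if_neg hn]
      refine squeeze_zero_norm (fun N => hb N n) ?_
      simpa [hn] using ((hwp.norm.pow n).const_mul C).mul_const (1 + ‖w‖ * ‖a‖ * ‖b‖ * ‖c‖)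

/-- The nonterminating very-well-poised `₆φ₅` summation. -/
theorem veryWellPoisedSum_eq (hq : ‖q‖ < 1) (hw : ‖w‖ < 1)
    (hx : ∀ k : ℕ, w * a * b * c * q ^ k ≠ 1) :
    veryWellPoisedSum a b c q w =
      qPochInf (w * a * q) q * qPochInf (w * b * q) q * qPochInf (w * c * q) q /
        qPochInf (w * q) q := by
  have hwq : ‖w * q‖ < 1 := by
    rw [norm_mul]; exact mul_lt_one_of_nonneg_of_lt_one_left (norm_nonneg _) hw hq.le
  have hiter (N : ℕ) : qPoch (w * q) q N * veryWellPoisedSum a b c q w =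
      qPoch (w * a * q) q N * qPoch (w * b * q) q N * qPoch (w * c * q) q N *
        veryWellPoisedSum a b c q (w * q ^ N) := by
    induction N with
    | zero => simp [qPoch]
    | succ N ih =>
      have hN : ‖w * q ^ N‖ < 1 := by
        rw [norm_mul, norm_pow]
        exact mul_lt_one_of_nonneg_of_lt_one_left (norm_nonneg _) hw
          (pow_le_one₀ (norm_nonneg q) hq.le)
      have h := veryWellPoisedSum_contiguous (a := a) (b := b) (c := c) hq hN fun k => by
        simpa [pow_add, mul_assoc, mul_comm, mul_left_comm] using hx (N + k)
      rw [mul_assoc w, ← pow_succ] at h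
      simp only [qPoch_succ]
      linear_combination (1 - w * q * q ^ N) * ih +
        qPoch (w * a * q) q N * qPoch (w * b * q) q N * qPoch (w * c * q) q N * h
  have hR := (((tendsto_qPoch hq (w * a * q)).mul (tendsto_qPoch hq (w * b * q))).mul
    (tendsto_qPoch hq (w * c * q))).mul (tendsto_veryWellPoisedSum (a := a) (b := b) (c := c) hq hw)
  have h := tendsto_nhds_unique (((tendsto_qPoch hq (w * q)).mul_const _).congr hiter) hR
  rw [eq_div_iff (qPochInf_ne_zero hq (mul_pow_ne_one hq hwq)), mul_comm, h, mul_one]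

/-- The series with numerator factor `1 - x² q^{4n}` is a multiple of the very-well-poised one. -/
lemma tsum_wellPoisedTerm_mul_one_sub (hq : ‖q‖ < 1) (hw : ‖w‖ < 1)
    (hx : ∀ k : ℕ, w * a * b * c * q ^ k ≠ 1) :
    (1 - w) * ∑' n : ℕ, wellPoisedTerm a b c q w n * (1 - (w * a * b * c) ^ 2 * (q ^ n) ^ 4) =
      ((1 - w * a) * (1 - w * b) * (1 - w * c) +
        (1 - w) * (w * (b * c + a * c + a * b) - w * (w * a * b * c))) *
        veryWellPoisedSum a b c q w := by
  have hp := tendsto_pow_atTop_nhds_zero_of_norm_lt_one hq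
  have hs1 := (summable_wellPoisedTerm_mul (a := a) (b := b) (c := c) hq hw
    (((hp.pow 4).const_mul ((w * a * b * c) ^ 2)).const_sub 1)).mul_left (1 - w)
  have hs2 := (summable_veryWellPoised (a := a) (b := b) (c := c) hq hw
    (w * a * b * c)).mul_left ((1 - w * a) * (1 - w * b) * (1 - w * c) +
        (1 - w) * (w * (b * c + a * c + a * b) - w * (w * a * b * c)))
  rw [← sub_eq_zero, veryWellPoisedSum, ← tsum_mul_left, ← tsum_mul_left, ← hs1.tsum_sub hs2]
  refine tsum_eq_zero_of_telescoping (hs1.sub hs2)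
    (G := fun n => wellPoisedTerm a b c q w n * -((1 - q ^ n) * (1 - w * b * c * q ^ n) *
      (1 - w * a * c * q ^ n) * (1 - w * a * b * q ^ n))) ?_ (by simp) fun n => ?_
  · exact (summable_wellPoisedTerm_mul hq hw ((((hp.const_sub 1).mul
      ((hp.const_mul _).const_sub 1)).mul ((hp.const_mul _).const_sub 1)).mul
      ((hp.const_mul _).const_sub 1)).neg).tendsto_atTop_zero
  · obtain ⟨V, h1, -, h3⟩ := exists_wellPoisedTerm_eq hq hx n
    simp only [h1, pow_succ q n]
    linear_combination ((1 - w * b * c * q * q ^ n) * (1 - w * a * c * q * q ^ n) *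
      (1 - w * a * b * q * q ^ n)) * h3

end WellPoised

/-- The evaluation of `H_{1,2}` obtained from Andrews' identities (3.7) and (3.4). -/
theorem H12_evaluation (q x a₁ a₂ a₃ : ℂ) (hq : ‖q‖ < 1)
    (ha : a₁ * a₂ * a₃ ≠ 0) (hxa : ‖x‖ < ‖a₁ * a₂ * a₃‖) (hx1 : x ≠ 1)
    (hxq : ∀ n : ℕ, x * q ^ (n + 1) ≠ 1)
    (hxq1 : ∀ n : ℕ, x * q ^ (n + 1) ≠ a₁)
    (hxq2 : ∀ n : ℕ, x * q ^ (n + 1) ≠ a₂)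
    (hxq3 : ∀ n : ℕ, x * q ^ (n + 1) ≠ a₃) :
    H12 a₁ a₂ a₃ x q =
      qPochInf (x / (a₁ * a₂)) q * qPochInf (x / (a₂ * a₃)) q * qPochInf (x / (a₃ * a₁)) q /
          qPochInf (x / (a₁ * a₂ * a₃)) q +
        x * (1 / a₁ + 1 / a₂ + 1 / a₃ - x / (a₁ * a₂ * a₃)) *
          (qPochInf (x * q / (a₁ * a₂)) q * qPochInf (x * q / (a₂ * a₃)) q *
              qPochInf (x * q / (a₃ * a₁)) q /
            qPochInf (x * q / (a₁ * a₂ * a₃)) q) := by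
  obtain ⟨h12, h3⟩ := mul_ne_zero_iff.1 ha
  obtain ⟨h1, h2⟩ := mul_ne_zero_iff.1 h12
  obtain ⟨w, rfl⟩ : ∃ w, x = w * a₁ * a₂ * a₃ := ⟨x / (a₁ * a₂ * a₃), by field_simp⟩
  have hw : ‖w‖ < 1 := by
    have h : ‖w‖ * ‖a₁ * a₂ * a₃‖ < 1 * ‖a₁ * a₂ * a₃‖ := by
      rw [← norm_mul, one_mul]; convert! hxa using 2; ring
    exact lt_of_mul_lt_mul_right h (norm_nonneg _)
  have hx (k : ℕ) : w * a₁ * a₂ * a₃ * q ^ k ≠ 1 := by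
    cases k with
    | zero => simpa using hx1
    | succ k => exact hxq k
  have e0 : w * a₁ * a₂ * a₃ / (a₁ * a₂ * a₃) = w := by field_simp
  have e0' : w * a₁ * a₂ * a₃ * q / (a₁ * a₂ * a₃) = w * q := by field_simp
  have e1 : w * a₁ * a₂ * a₃ * q / a₁ = w * a₂ * a₃ * q := by field_simp
  have e2 : w * a₁ * a₂ * a₃ * q / a₂ = w * a₁ * a₃ * q := by field_simp
  have e3 : w * a₁ * a₂ * a₃ * q / a₃ = w * a₁ * a₂ * q := by field_simp
  have e12 : w * a₁ * a₂ * a₃ / (a₁ * a₂) = w * a₃ := by field_simp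
  have e23 : w * a₁ * a₂ * a₃ / (a₂ * a₃) = w * a₁ := by field_simp
  have e31 : w * a₁ * a₂ * a₃ / (a₃ * a₁) = w * a₂ := by field_simp
  have e12' : w * a₁ * a₂ * a₃ * q / (a₁ * a₂) = w * a₃ * q := by field_simp
  have e23' : w * a₁ * a₂ * a₃ * q / (a₂ * a₃) = w * a₁ * q := by field_simp
  have e31' : w * a₁ * a₂ * a₃ * q / (a₃ * a₁) = w * a₂ * q := by field_simp
  have hd1 (k : ℕ) : w * a₂ * a₃ * q * q ^ k ≠ 1 := fun h =>
    hxq1 k (by rw [pow_succ]; linear_combination a₁ * h)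
  have hd2 (k : ℕ) : w * a₁ * a₃ * q * q ^ k ≠ 1 := fun h =>
    hxq2 k (by rw [pow_succ]; linear_combination a₂ * h)
  have hd3 (k : ℕ) : w * a₁ * a₂ * q * q ^ k ≠ 1 := fun h =>
    hxq3 k (by rw [pow_succ]; linear_combination a₃ * h)
  have hH : H12 a₁ a₂ a₃ (w * a₁ * a₂ * a₃) q = ∑' n : ℕ, wellPoisedTerm a₁ a₂ a₃ q w n *
      (1 - (w * a₁ * a₂ * a₃) ^ 2 * (q ^ n) ^ 4) := by
    rw [H12, ← tsum_mul_left]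
    refine tsum_congr fun n => ?_
    rw [e0, e1, e2, e3, ← qPoch_mul_qPochInf hq (w * a₂ * a₃ * q) n,
      ← qPoch_mul_qPochInf hq (w * a₁ * a₃ * q) n, ← qPoch_mul_qPochInf hq (w * a₁ * a₂ * q) n]
    have hp1 := qPoch_ne_zero hd1 n
    have hp2 := qPoch_ne_zero hd2 n
    have hp3 := qPoch_ne_zero hd3 n
    have hQ : qPoch q q n ≠ 0 := qPoch_ne_zero (mul_pow_ne_one hq hq) n
    have hx0 : 1 - w * a₁ * a₂ * a₃ ≠ 0 := sub_ne_zero.2 hx1.symm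
    have hX : qPochInf (w * a₁ * a₂ * a₃ * q) q ≠ 0 := qPochInf_ne_zero hq fun k => by
      simpa [pow_succ', mul_assoc] using hxq k
    have hXn : qPochInf (w * a₁ * a₂ * a₃ * q ^ n) q ≠ 0 := qPochInf_ne_zero hq fun k => by
      simpa [pow_add, mul_assoc] using hx (n + k)
    have hXX := (qPoch_mul_qPochInf hq (w * a₁ * a₂ * a₃) n).trans
      (one_sub_mul_qPochInf hq (w * a₁ * a₂ * a₃)).symm
    have hpq : qPoch (w * a₁ * a₂ * a₃) q n = (1 - w * a₁ * a₂ * a₃) *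
        qPochInf (w * a₁ * a₂ * a₃ * q) q / qPochInf (w * a₁ * a₂ * a₃ * q ^ n) q := by
      rw [eq_div_iff hXn, hXX]
    rw [hpq]
    simp only [wellPoisedTerm, wellPoisedTail, wellPoisedHead, pow_succ' q n, pow_mul', ← mul_assoc]
    clear hpq hXX
    generalize qPoch (w * a₂ * a₃ * q) q n = P₁ at *
    generalize qPoch (w * a₁ * a₃ * q) q n = P₂ at *
    generalize qPoch (w * a₁ * a₂ * q) q n = P₃ at *
    generalize 1 - w * a₁ * a₂ * a₃ = d at *
    generalize qPochInf (w * a₁ * a₂ * a₃ * q) q = X at *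
    generalize qPochInf (w * a₁ * a₂ * a₃ * q ^ n) q = Y at *
    field_simp
  have hw1 : 1 - w ≠ 0 := sub_ne_zero.2 fun h => by simp [← h] at hw
  have hwq : qPochInf (w * q) q ≠ 0 := qPochInf_ne_zero hq fun k => by
    simpa [pow_succ', mul_assoc] using mul_pow_ne_one hq hw (k + 1)
  have hmain := tsum_wellPoisedTerm_mul_one_sub hq hw hx
  rw [← hH, veryWellPoisedSum_eq hq hw hx] at hmain
  rw [e0, e0', e12, e23, e31, e12', e23', e31', ← one_sub_mul_qPochInf hq w,
    ← one_sub_mul_qPochInf hq (w * a₁), ← one_sub_mul_qPochInf hq (w * a₂),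
    ← one_sub_mul_qPochInf hq (w * a₃)]
  have hP : w * a₁ * a₂ * a₃ * (1 / a₁ + 1 / a₂ + 1 / a₃ - w) =
      w * (a₂ * a₃ + a₁ * a₃ + a₁ * a₂) - w * (w * a₁ * a₂ * a₃) := by
    field_simp
  rw [hP]
  refine mul_left_cancel₀ hw1 (hmain.trans ?_)
  field_simp
end
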